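/- Let W be an n×n complex symmetric matrix with I − W·conj(W) positive definite. Then I − W is invertible, the matrix ψ(W) = i(I + W)(I − W)^{-1} lies in the Siegel half-space H_n (it is symmetric with positive definite imaginary part), and φ(ψ(W)) = W. Hence φ : H_n → D_n is a bijection with inverse ψ. -/

import Mathlib

noncomputable section
open Matrix Complex
open scoped ComplexOrder

/-- Entrywise complex conjugation of a matrix. -/
def mconj {n : ℕ} (A : Matrix (Fin n) (Fin n) ℂ) : Matrix (Fin n) (Fin n) ℂ :=
  A.map (starRingEnd ℂ)

/-- The imaginary part `Im Z = (Z - conj Z)/(2i)` of a complex matrix. -/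
def imPart {n : ℕ} (Z : Matrix (Fin n) (Fin n) ℂ) : Matrix (Fin n) (Fin n) ℂ :=
  (2 * Complex.I)⁻¹ • (Z - mconj Z)

/-- The Cayley transform `φ(Z) = (Z - iI)(Z + iI)⁻¹`. -/
def phi {n : ℕ} (Z : Matrix (Fin n) (Fin n) ℂ) : Matrix (Fin n) (Fin n) ℂ :=
  (Z - Complex.I • 1) * (Z + Complex.I • 1)⁻¹

/-- The inverse Cayley transform `ψ(W) = i(I + W)(I − W)⁻¹`. -/
def psi {n : ℕ} (W : Matrix (Fin n) (Fin n) ℂ) : Matrix (Fin n) (Fin n) ℂ :=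
  Complex.I • ((1 + W) * (1 - W)⁻¹)

/-- The Siegel half-space `H_n`, as a set of complex symmetric matrices. -/
def SiegelH (n : ℕ) : Set (Matrix (Fin n) (Fin n) ℂ) :=
  {Z | Z.IsSymm ∧ (imPart Z).PosDef}

/-- The matrix disk `D_n`, the set of complex symmetric `W` with `I − W·conj W ≻ 0`. -/
def DiskD (n : ℕ) : Set (Matrix (Fin n) (Fin n) ℂ) :=
  {W | W.IsSymm ∧ ((1 : Matrix (Fin n) (Fin n) ℂ) - W * mconj W).PosDef}

section CayleyTransform

variable {n : ℕ}

theorem mconj_eq_conjTranspose {A : Matrix (Fin n) (Fin n) ℂ} (hA : A.IsSymm) :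
    mconj A = Aᴴ := by
  rw [conjTranspose, hA.eq]
  rfl

/-- A square matrix `A` is invertible as soon as some `A * B + C * Aᴴ` is positive definite. -/
theorem isUnit_of_posDef_add {A B C : Matrix (Fin n) (Fin n) ℂ}
    (h : (A * B + C * Aᴴ).PosDef) : IsUnit A := by
  rw [← isUnit_conjTranspose, ← mulVec_injective_iff_isUnit]
  refine (injective_iff_map_eq_zero (mulVecLin Aᴴ)).2 fun x hx => ?_
  rw [mulVecLin_apply] at hx
  by_contra hne
  have hA : star x ᵥ* A = 0 := by
    simpa [star_mulVec] using congrArg star hx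
  have hlt := h.dotProduct_mulVec_pos hne
  rw [add_mulVec, dotProduct_add, ← mulVec_mulVec, ← mulVec_mulVec, hx,
    dotProduct_mulVec, hA] at hlt
  simp at hlt

theorem inv_mul_eq_mul_inv_of_commute {A C : Matrix (Fin n) (Fin n) ℂ}
    (hA : IsUnit A) (h : Commute A C) : A⁻¹ * C = C * A⁻¹ := by
  have hd := (isUnit_iff_isUnit_det A).1 hA
  calc A⁻¹ * C = A⁻¹ * (C * A) * A⁻¹ := by
        rw [← mul_assoc, mul_nonsing_inv_cancel_right _ _ hd]
    _ = C * A⁻¹ := by rw [← h.eq, nonsing_inv_mul_cancel_left _ _ hd]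

theorem isSymm_mul_inv_of_commute {A C : Matrix (Fin n) (Fin n) ℂ}
    (hA : IsUnit A) (h : Commute A C) (hAs : A.IsSymm) (hCs : C.IsSymm) :
    (C * A⁻¹).IsSymm := by
  rw [IsSymm, transpose_mul, transpose_nonsing_inv, hAs.eq, hCs.eq,
    inv_mul_eq_mul_inv_of_commute hA h]

section Disk

variable {W : Matrix (Fin n) (Fin n) ℂ}

theorem isUnit_one_sub_of_mem_diskD (hW : W ∈ DiskD n) : IsUnit (1 - W) := by
  obtain ⟨hs, hp⟩ := hW
  rw [mconj_eq_conjTranspose hs] at hp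
  refine isUnit_of_posDef_add (B := 1) (C := W) ?_
  convert hp using 1
  rw [conjTranspose_sub, conjTranspose_one]
  noncomm_ring

theorem commute_one_sub_one_add (W : Matrix (Fin n) (Fin n) ℂ) : Commute (1 - W) (1 + W) := by
  rw [commute_iff_eq]
  noncomm_ring

theorem psi_mul_one_sub (h : IsUnit (1 - W)) : psi W * (1 - W) = I • (1 + W) := by
  rw [psi, smul_mul_assoc, nonsing_inv_mul_cancel_right _ _ ((isUnit_iff_isUnit_det _).1 h)]

theorem one_sub_mul_psi (h : IsUnit (1 - W)) : (1 - W) * psi W = I • (1 + W) := by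
  rw [psi, ← inv_mul_eq_mul_inv_of_commute h (commute_one_sub_one_add W), mul_smul_comm,
    mul_nonsing_inv_cancel_left _ _ ((isUnit_iff_isUnit_det _).1 h)]

theorem psi_isSymm (h : IsUnit (1 - W)) (hs : W.IsSymm) : (psi W).IsSymm :=
  (isSymm_mul_inv_of_commute h (commute_one_sub_one_add W) (isSymm_one.sub hs)
    (isSymm_one.add hs)).smul I

theorem psi_mem_siegelH (hW : W ∈ DiskD n) : psi W ∈ SiegelH n := by
  have hu := isUnit_one_sub_of_mem_diskD hW
  obtain ⟨hs, hp⟩ := hW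
  have hZs := psi_isSymm hu hs
  refine ⟨hZs, ?_⟩
  rw [← IsUnit.posDef_star_right_conjugate_iff hu]
  rw [mconj_eq_conjTranspose hs] at hp
  convert hp using 1
  have h1 := one_sub_mul_psi hu
  have h2 : (psi W)ᴴ * (1 - W)ᴴ = -I • (1 + Wᴴ) := by
    simpa [conjTranspose_mul] using congrArg conjTranspose h1
  rw [imPart, mconj_eq_conjTranspose hZs, star_eq_conjTranspose, mul_smul_comm, smul_mul_assoc,
    mul_sub, sub_mul, h1, mul_assoc (1 - W), h2, conjTranspose_sub, conjTranspose_one,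
    inv_smul_eq_iff₀ (by simp), smul_mul_assoc, mul_smul_comm, neg_smul, sub_neg_eq_add,
    ← smul_add, mul_comm, mul_smul]
  congr 1
  rw [two_smul]
  noncomm_ring

end Disk

section Siegel

variable {Z : Matrix (Fin n) (Fin n) ℂ}

theorem isUnit_add_I_of_mem_siegelH (hZ : Z ∈ SiegelH n) :
    IsUnit (Z + I • (1 : Matrix (Fin n) (Fin n) ℂ)) := by
  obtain ⟨hs, hp⟩ := hZ
  refine isUnit_of_posDef_add (B := (2 * I)⁻¹ • 1) (C := -(2 * I)⁻¹ • 1) ?_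
  convert hp.add PosDef.one using 1
  have hI : (2 * I)⁻¹ * I = 1 / 2 := by field_simp
  rw [imPart, mconj_eq_conjTranspose hs]
  simp only [conjTranspose_add, conjTranspose_smul, conjTranspose_one, mul_smul_comm,
    smul_mul_assoc, mul_one, one_mul, Complex.star_def, conj_I]
  match_scalars
  · ring
  · linear_combination 2 * hI
  · ring

theorem phi_mul_add_I (h : IsUnit (Z + I • (1 : Matrix (Fin n) (Fin n) ℂ))) :
    phi Z * (Z + I • 1) = Z - I • 1 := by
  rw [phi, nonsing_inv_mul_cancel_right _ _ ((isUnit_iff_isUnit_det _).1 h)]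

theorem commute_add_I_sub_I (Z : Matrix (Fin n) (Fin n) ℂ) :
    Commute (Z + I • 1) (Z - I • 1) :=
  have h : Commute Z (I • 1) := (Commute.one_right Z).smul_right I
  ((Commute.refl Z).sub_right h).add_left (h.symm.sub_right (Commute.refl _))

theorem add_I_mul_phi (h : IsUnit (Z + I • (1 : Matrix (Fin n) (Fin n) ℂ))) :
    (Z + I • 1) * phi Z = Z - I • 1 := by
  rw [phi, ← inv_mul_eq_mul_inv_of_commute h (commute_add_I_sub_I Z),
    mul_nonsing_inv_cancel_left _ _ ((isUnit_iff_isUnit_det _).1 h)]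

theorem phi_mem_diskD (hZ : Z ∈ SiegelH n) : phi Z ∈ DiskD n := by
  have hu := isUnit_add_I_of_mem_siegelH hZ
  obtain ⟨hs, hp⟩ := hZ
  have hWs : (phi Z).IsSymm :=
    isSymm_mul_inv_of_commute hu (commute_add_I_sub_I Z) (hs.add (isSymm_one.smul I))
      (hs.sub (isSymm_one.smul I))
  refine ⟨hWs, ?_⟩
  rw [← IsUnit.posDef_star_right_conjugate_iff hu, mconj_eq_conjTranspose hWs]
  convert hp.smul (show (0 : ℂ) < 4 by norm_num) using 1
  have h1 := add_I_mul_phi hu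
  have h2 : (phi Z)ᴴ * (Z + I • 1)ᴴ = Zᴴ + I • 1 := by
    simpa [conjTranspose_mul] using congrArg conjTranspose h1
  have hI : (4 : ℂ) * (2 * I)⁻¹ = -(2 * I) := by
    field_simp
    simp
    norm_num
  rw [imPart, mconj_eq_conjTranspose hs, smul_smul, hI, star_eq_conjTranspose, mul_sub, sub_mul,
    mul_one, ← mul_assoc, h1, mul_assoc _ (phi Z)ᴴ, h2]
  simp only [conjTranspose_add, conjTranspose_smul, conjTranspose_one, Complex.star_def, conj_I,
    add_mul, mul_add, sub_mul, smul_mul_assoc, mul_smul_comm, mul_one, one_mul]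
  module

theorem psi_phi (hZ : Z ∈ SiegelH n) : psi (phi Z) = Z := by
  have hu := isUnit_add_I_of_mem_siegelH hZ
  have hv := isUnit_one_sub_of_mem_diskD (phi_mem_diskD hZ)
  have h1 := phi_mul_add_I hu
  refine hv.mul_left_injective (hu.mul_left_injective ?_)
  simp only
  rw [psi_mul_one_sub hv, smul_mul_assoc, mul_assoc, add_mul, sub_mul, h1, one_mul,
    add_sub_sub_cancel]
  simp only [mul_add, mul_smul_comm, mul_one]
  module

end Siegel

theorem phi_psi {W : Matrix (Fin n) (Fin n) ℂ} (hW : W ∈ DiskD n) : phi (psi W) = W := by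
  have hv := isUnit_one_sub_of_mem_diskD hW
  have hu := isUnit_add_I_of_mem_siegelH (psi_mem_siegelH hW)
  refine hu.mul_left_injective (hv.mul_left_injective ?_)
  simp only
  rw [phi_mul_add_I hu, mul_assoc, sub_mul, add_mul, psi_mul_one_sub hv]
  simp only [mul_add, mul_sub, smul_mul_assoc, mul_smul_comm, mul_one, one_mul]
  module

end CayleyTransform

/-- For `W` in the matrix disk `D_n`: `I − W` is invertible, `ψ(W)` lies in the Siegel
half-space (it is symmetric with positive definite imaginary part), and `φ(ψ(W)) = W`.
Hence `φ : H_n → D_n` is a bijection with inverse `ψ`. -/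
theorem cayley_bijection {n : ℕ} (W : Matrix (Fin n) (Fin n) ℂ)
    (hsymm : W.IsSymm)
    (hpos : ((1 : Matrix (Fin n) (Fin n) ℂ) - W * mconj W).PosDef) :
    IsUnit (1 - W) ∧
    (psi W).IsSymm ∧
    (imPart (psi W)).PosDef ∧
    phi (psi W) = W ∧
    Set.BijOn phi (SiegelH n) (DiskD n) := by
  have hW : W ∈ DiskD n := ⟨hsymm, hpos⟩
  obtain ⟨hs, hp⟩ := psi_mem_siegelH hW
  exact ⟨isUnit_one_sub_of_mem_diskD hW, hs, hp, phi_psi hW,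
    Set.InvOn.bijOn ⟨fun _ => psi_phi, fun _ => phi_psi⟩ (fun _ => phi_mem_diskD)
      (fun _ => psi_mem_siegelH)⟩
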